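/- arXiv:1912.09071 — 2 statements merged into one kernel-verified Lean document; each statement's English description precedes it below -/
import Mathlib

section
/- Let N ≥ 3, 0 ≤ α < 2, p > 1, ε > 0, and set γ = (α−2)(p−1). Then for every nonnegative u ∈ C_c^∞(ℝ^N; ℝ): ∫_{ℝ^N} W_ε^{p−1} u^{p−2} |∇u|² dx ≥ ∫_{ℝ^N} |x|^{−α} W_ε^p u^p [ ((N−2)/p)² |x|^{α−2} W_ε^{−1} − (γ²/p²) |x|^{2−α} W_ε + (2γ/p²)( N − α + p(α−2) |x|^{2−α} W_ε ) ] dx, where the integrand on the left is understood to vanish at points where u vanishes. -/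
open MeasureTheory Real

noncomputable section

/-- The `i`-th partial derivative of a real-valued function on `ℝ^N`. -/
def pdR {N : ℕ} (i : Fin N) (f : EuclideanSpace ℝ (Fin N) → ℝ)
    (x : EuclideanSpace ℝ (Fin N)) : ℝ :=
  fderiv ℝ f x (EuclideanSpace.single i 1)

/-- The Yosida approximation `W_ε(x) = 1/(|x|^{2-α} + ε)` of the potential `|x|^{α-2}`. -/
def Weps {N : ℕ} (α ε : ℝ) (x : EuclideanSpace ℝ (Fin N)) : ℝ :=
  1 / (‖x‖ ^ (2 - α) + ε)

section PolarDivergence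

variable {E : Type*} [NormedAddCommGroup E] [NormedSpace ℝ E]

lemma hasDerivAt_ray {ψ : E → ℝ} {x : E} {c r : ℝ} (hr : 0 < r)
    (h : HasDerivAt (fun t : ℝ => ψ (t • r • x)) c 1) :
    HasDerivAt (fun t : ℝ => ψ (t • x)) (c / r) r := by
  have h1 : HasDerivAt (fun t : ℝ => t / r) (1 / r) r := (hasDerivAt_id r).div_const r
  have h2 : HasDerivAt (fun t : ℝ => ψ (t • r • x)) c (r / r) := by rwa [div_self hr.ne']
  have h3 := HasDerivAt.comp (h := fun t : ℝ => t / r) r h2 h1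
  refine (h3.congr_deriv (by ring)).congr_of_eventuallyEq (Filter.Eventually.of_forall fun t => ?_)
  simp [smul_smul, div_mul_cancel₀ _ hr.ne']

lemma integral_ray_divergence_eq_zero {n : ℕ} (hn : 3 ≤ n) {ψ ψ' : E → ℝ} {C R : ℝ}
    (hd : ∀ x ≠ 0, HasDerivAt (fun t : ℝ => ψ (t • x)) (ψ' x) 1)
    (hC : ∀ x, |ψ x| ≤ C) (hR : ∀ x, R ≤ ‖x‖ → ψ x = 0) {θ : E} (hθ : ‖θ‖ = 1) :
    ∫ r in Set.Ioi (0 : ℝ),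
      r ^ (n - 1) * ((r ^ 2)⁻¹ * (((n : ℝ) - 2) * ψ (r • θ) + ψ' (r • θ))) = 0 := by
  by_cases hint : IntegrableOn (fun r : ℝ =>
      r ^ (n - 1) * ((r ^ 2)⁻¹ * (((n : ℝ) - 2) * ψ (r • θ) + ψ' (r • θ)))) (Set.Ioi 0)
  swap
  · exact integral_undef hint
  obtain ⟨m, rfl⟩ : ∃ m, n = m + 3 := ⟨n - 3, by omega⟩
  have hθ0 : θ ≠ 0 := by
    rintro rfl
    simp at hθ
  have key := integral_Ioi_of_hasDerivAt_of_tendsto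
    (f := fun r : ℝ => r ^ (m + 1) * ψ (r • θ)) (a := 0) (m := 0) ?_ ?_ hint ?_
  · rwa [zero_smul, zero_pow m.succ_ne_zero, zero_mul, sub_zero] at key
  · rw [ContinuousWithinAt]
    rw [zero_pow m.succ_ne_zero, zero_mul]
    have hb : Filter.Tendsto (fun r : ℝ => |r| ^ (m + 1) * C) (nhdsWithin 0 (Set.Ici 0))
        (nhds 0) := by
      have : Continuous fun r : ℝ => |r| ^ (m + 1) * C := by fun_prop
      simpa using (this.tendsto 0).mono_left nhdsWithin_le_nhds
    refine squeeze_zero_norm (fun r => ?_) hb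
    rw [norm_mul, norm_pow, Real.norm_eq_abs, Real.norm_eq_abs]
    gcongr
    exact hC _
  · intro r (hr : 0 < r)
    have h1 := hasDerivAt_ray hr (hd (r • θ) (smul_ne_zero hr.ne' hθ0))
    refine ((hasDerivAt_pow (m + 1) r).mul h1).congr_deriv ?_
    push_cast
    field_simp
    ring
  · refine tendsto_const_nhds.congr' ?_
    filter_upwards [Filter.eventually_ge_atTop (max R 0)] with r hr
    rw [hR, mul_zero]
    rw [norm_smul, hθ, mul_one, Real.norm_eq_abs]
    exact (le_max_left _ _).trans (hr.trans (le_abs_self r))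

variable [FiniteDimensional ℝ E] [MeasurableSpace E] [BorelSpace E]

open Measure in
/-- The field `‖x‖⁻² ψ(x) x` has divergence of zero integral: `ψ'` is the derivative of `ψ`
in the direction of the identity field. -/
lemma integral_inv_sq_divergence_eq_zero (μ : Measure E) [μ.IsAddHaarMeasure]
    (hn : 3 ≤ Module.finrank ℝ E) {ψ ψ' : E → ℝ} {C R : ℝ}
    (hd : ∀ x ≠ 0, HasDerivAt (fun t : ℝ => ψ (t • x)) (ψ' x) 1)
    (hC : ∀ x, |ψ x| ≤ C) (hR : ∀ x, R ≤ ‖x‖ → ψ x = 0)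
    (hint : Integrable (fun x =>
      (‖x‖ ^ 2)⁻¹ * (((Module.finrank ℝ E : ℝ) - 2) * ψ x + ψ' x)) μ) :
    ∫ x, (‖x‖ ^ 2)⁻¹ * (((Module.finrank ℝ E : ℝ) - 2) * ψ x + ψ' x) ∂μ = 0 := by
  have : Nontrivial E := Module.nontrivial_of_finrank_pos (R := ℝ) (by omega)
  set n := Module.finrank ℝ E with hndef
  set F : E → ℝ := fun x => (‖x‖ ^ 2)⁻¹ * (((n : ℝ) - 2) * ψ x + ψ' x) with hF
  have mp := μ.measurePreserving_homeomorphUnitSphereProd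
  have emb := (homeomorphUnitSphereProd E).measurableEmbedding
  set G : Metric.sphere (0 : E) 1 × Set.Ioi (0 : ℝ) → ℝ := fun y => F (y.2.1 • y.1.1) with hG
  have hGF : ∀ x : ({0}ᶜ : Set E), G (homeomorphUnitSphereProd E x) = F x := by
    intro x
    have hx : ‖(x : E)‖ ≠ 0 := norm_ne_zero_iff.2 x.2
    simp [hG, smul_smul, hx]
  have e1 : ∫ x, F x ∂μ = ∫ y, G y ∂(μ.toSphere.prod (volumeIoiPow (n - 1))) := by
    rw [← mp.integral_comp emb G]
    simp only [hGF]
    rw [integral_subtype_comap (measurableSet_singleton _).compl F, restrict_compl_singleton]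
  have hGint : Integrable G (μ.toSphere.prod (volumeIoiPow (n - 1))) := by
    rw [← mp.integrable_comp_emb emb]
    have : G ∘ homeomorphUnitSphereProd E = F ∘ Subtype.val := funext hGF
    rw [this, ← integrableOn_iff_comap_subtypeVal (measurableSet_singleton _).compl]
    exact hint.integrableOn
  rw [e1, integral_prod _ hGint]
  refine integral_eq_zero_of_ae (Filter.Eventually.of_forall fun θ => ?_)
  have hθ : ‖(θ : E)‖ = 1 := by simp
  refine Eq.trans ?_ (integral_ray_divergence_eq_zero hn hd hC hR hθ)
  simp only [volumeIoiPow, ENNReal.ofReal]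
  rw [integral_withDensity_eq_integral_smul (by fun_prop),
    integral_subtype_comap measurableSet_Ioi
      fun r : ℝ => Real.toNNReal (r ^ (n - 1)) • F (r • (θ : E))]
  refine setIntegral_congr_fun measurableSet_Ioi fun r hr => ?_
  have hr' : (0 : ℝ) < r := hr
  simp only [NNReal.smul_def, Real.coe_toNNReal _ (pow_nonneg hr'.le _), smul_eq_mul, hF,
    norm_smul, hθ, Real.norm_eq_abs, mul_one, sq_abs]

lemma integrable_inv_sq_mul (μ : Measure E) [μ.IsAddHaarMeasure]
    (hn : 3 ≤ Module.finrank ℝ E) {f : E → ℝ} (hf : Continuous f) (hfs : HasCompactSupport f) :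
    Integrable (fun x => (‖x‖ ^ 2)⁻¹ * f x) μ := by
  have : Nontrivial E := Module.nontrivial_of_finrank_pos (R := ℝ) (by omega)
  obtain ⟨C, hC⟩ := hfs.exists_bound_of_continuous hf
  obtain ⟨R, hR⟩ := hfs.isCompact.isBounded.subset_ball 0
  have h1 : IntegrableOn (fun x : E => (‖x‖ ^ 2)⁻¹) (Metric.ball 0 R) μ := by
    rw [integrableOn_fun_norm_addHaar μ (f := fun r : ℝ => (r ^ 2)⁻¹)]
    obtain ⟨m, hm⟩ : ∃ m, Module.finrank ℝ E = m + 3 := ⟨Module.finrank ℝ E - 3, by omega⟩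
    have h2 : IntegrableOn (fun r : ℝ => r ^ m) (Set.Ioo 0 R) :=
      (Continuous.integrableOn_Icc (by fun_prop)).mono_set Set.Ioo_subset_Icc_self
    refine h2.congr_fun (fun r hr => ?_) measurableSet_Ioo
    have : r ≠ 0 := hr.1.ne'
    simp only [hm, smul_eq_mul, show m + 3 - 1 = m + 2 by omega]
    field_simp
    ring
  have h3 : IntegrableOn (fun x : E => (‖x‖ ^ 2)⁻¹ * f x) (Metric.ball 0 R) μ :=
    h1.mul_bdd hf.aestronglyMeasurable (Filter.Eventually.of_forall hC)
  refine (integrableOn_iff_integrable_of_support_subset fun x hx => hR ?_).1 h3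
  exact subset_tsupport f (right_ne_zero_of_mul hx)

end PolarDivergence

/-- The gradient of a nonnegative smooth function is controlled by the square root of the
function. -/
lemma exists_sq_fderiv_le {E : Type*} [NormedAddCommGroup E] [NormedSpace ℝ E]
    {u : E → ℝ} (hu : ContDiff ℝ 2 u) (hus : HasCompactSupport u) (hupos : ∀ x, 0 ≤ u x) :
    ∃ L : ℝ, 0 ≤ L ∧ ∀ x v, fderiv ℝ u x v ^ 2 ≤ L * ‖v‖ ^ 2 * u x := by
  obtain ⟨K, hK⟩ := ContDiff.lipschitzWith_of_hasCompactSupport (𝕂 := ℝ) (n := 1)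
    (hus.fderiv ℝ) (hu.fderiv_right (by norm_num)) (by simp)
  refine ⟨4 * K, by positivity, fun x v => ?_⟩
  have key : ∀ t : ℝ, 0 ≤ (K * ‖v‖ ^ 2) * (t * t) + fderiv ℝ u x v * t + u x := by
    intro t
    have h := (convex_closedBall x ‖t • v‖).norm_image_sub_le_of_norm_fderiv_le' (𝕜 := ℝ)
      (f := u) (φ := fderiv ℝ u x) (C := K * ‖t • v‖) (x := x) (y := x + t • v)
      (fun y _ => hu.differentiable (by norm_num) y) (fun y hy => ?_) (by simp) (by simp)
    · have h2 := (abs_le.1 h).2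
      have h3 := hupos (x + t • v)
      simp only [add_sub_cancel_left, map_smul, smul_eq_mul, norm_smul, Real.norm_eq_abs] at h2
      have h4 : K * (|t| * ‖v‖) * (|t| * ‖v‖) = (K * ‖v‖ ^ 2) * (t * t) := by
        rw [← abs_mul_abs_self t]
        ring
      linarith
    · refine (hK.norm_sub_le y x).trans ?_
      gcongr
      simpa [dist_eq_norm] using hy
  have := discrim_le_zero key
  rw [discrim] at this
  linarith

section Weps

variable {N : ℕ} {α ε : ℝ}

lemma Weps_pos (hε : 0 < ε) (x : EuclideanSpace ℝ (Fin N)) : 0 < Weps α ε x := by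
  unfold Weps
  have := Real.rpow_nonneg (norm_nonneg x) (2 - α)
  positivity

lemma continuous_Weps (hα2 : α < 2) (hε : 0 < ε) :
    Continuous (Weps α ε : EuclideanSpace ℝ (Fin N) → ℝ) := by
  unfold Weps
  refine continuous_const.div
    ((continuous_norm.rpow_const fun _ => Or.inr (by linarith)).add continuous_const) fun x => ?_
  have := Real.rpow_nonneg (norm_nonneg x) (2 - α)
  positivity

lemma norm_rpow_mul_Weps (hε : 0 < ε) (x : EuclideanSpace ℝ (Fin N)) :
    ‖x‖ ^ (2 - α) * Weps α ε x = 1 - ε * Weps α ε x := by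
  unfold Weps
  have := Real.rpow_nonneg (norm_nonneg x) (2 - α)
  have : ‖x‖ ^ (2 - α) + ε ≠ 0 := by positivity
  field_simp
  ring

lemma hasDerivAt_Weps_ray (hε : 0 < ε) (x : EuclideanSpace ℝ (Fin N)) :
    HasDerivAt (fun t : ℝ => Weps α ε (t • x))
      ((α - 2) * (1 - ε * Weps α ε x) * Weps α ε x) 1 := by
  have h0 := Real.rpow_nonneg (norm_nonneg x) (2 - α)
  have h1 : HasDerivAt (fun t : ℝ => t ^ (2 - α) * ‖x‖ ^ (2 - α) + ε)
      ((2 - α) * ‖x‖ ^ (2 - α)) 1 := by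
    simpa using ((Real.hasDerivAt_rpow_const (x := 1) (p := 2 - α)
      (Or.inl one_ne_zero)).mul_const (‖x‖ ^ (2 - α))).add_const ε
  have h2 := h1.inv (by rw [Real.one_rpow]; positivity)
  refine (h2.congr_deriv ?_).congr_of_eventuallyEq ?_
  · rw [← norm_rpow_mul_Weps hε, Real.one_rpow, one_mul, Weps]
    field_simp
    ring
  · filter_upwards [lt_mem_nhds zero_lt_one] with t ht
    rw [Weps, norm_smul, Real.norm_of_nonneg ht.le, Real.mul_rpow ht.le (norm_nonneg x)]
    simp

/-- The derivative along rays of `W^{p-1} (a s + c) u^p`, where `s = |x|^{2-α} W = 1 - ε W`. -/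
lemma hasDerivAt_Weps_rpow_mul_ray {p : ℝ} (hp : 1 < p) (hε : 0 < ε) (a c : ℝ)
    {u : EuclideanSpace ℝ (Fin N) → ℝ} (hu : Differentiable ℝ u) (x : EuclideanSpace ℝ (Fin N)) :
    HasDerivAt (fun t : ℝ => Weps α ε (t • x) ^ (p - 1) *
        (a * (1 - ε * Weps α ε (t • x)) + c) * u (t • x) ^ p)
      (Weps α ε x ^ (p - 1) * (((α - 2) * (p - 1) * (1 - ε * Weps α ε x)) *
        (a * (1 - ε * Weps α ε x) + c) -
          a * (α - 2) * (1 - ε * Weps α ε x) * (ε * Weps α ε x)) * u x ^ p +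
        Weps α ε x ^ (p - 1) * (a * (1 - ε * Weps α ε x) + c) *
          (p * u x ^ (p - 1) * fderiv ℝ u x x)) 1 := by
  have hW := hasDerivAt_Weps_ray (α := α) hε x
  have hpos := Weps_pos (α := α) hε x
  have h1 := hW.rpow_const (p := p - 1) (Or.inl (by rw [one_smul]; exact hpos.ne'))
  have h2 := (((hW.const_mul ε).const_sub 1).const_mul a).add_const c
  have h3 : HasDerivAt (fun t : ℝ => u (t • x)) (fderiv ℝ u x x) 1 := by
    have h4 : HasDerivAt (fun t : ℝ => t • x) x 1 := by
      simpa using (hasDerivAt_id (1 : ℝ)).smul_const x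
    have h5 : HasFDerivAt u (fderiv ℝ u x) ((1 : ℝ) • x) := by
      rw [one_smul]
      exact (hu x).hasFDerivAt
    exact h5.comp_hasDerivAt 1 h4
  have h6 := h3.rpow_const (p := p) (Or.inr hp.le)
  refine ((h1.mul h2).mul h6).congr_deriv ?_
  simp only [Pi.mul_apply, one_smul]
  rw [Real.rpow_sub_one hpos.ne' (p - 1)]
  field_simp
  ring

end Weps

lemma sum_pdR_mul {N : ℕ} (u : EuclideanSpace ℝ (Fin N) → ℝ) (x : EuclideanSpace ℝ (Fin N)) :
    ∑ i, pdR i u x * x i = fderiv ℝ u x x := by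
  have hx : x = ∑ i, x i • EuclideanSpace.single i (1 : ℝ) := by
    ext j
    simp [Finset.sum_apply, Pi.single_apply]
  conv_rhs => rw [hx, map_sum, ← hx]
  simp [pdR, mul_comm]

lemma sum_pdR_sq_ge {N : ℕ} (u : EuclideanSpace ℝ (Fin N) → ℝ) (x : EuclideanSpace ℝ (Fin N))
    (b : ℝ) : -(2 * b * fderiv ℝ u x x + b ^ 2 * ‖x‖ ^ 2) ≤ ∑ i, pdR i u x ^ 2 := by
  have h : 0 ≤ ∑ i, (pdR i u x + b * x i) ^ 2 := Finset.sum_nonneg fun i _ => sq_nonneg _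
  have e : ∑ i, (pdR i u x + b * x i) ^ 2 =
      ∑ i, pdR i u x ^ 2 + 2 * b * fderiv ℝ u x x + b ^ 2 * ‖x‖ ^ 2 := by
    rw [← sum_pdR_mul, EuclideanSpace.real_norm_sq_eq, Finset.mul_sum, Finset.mul_sum,
      ← Finset.sum_add_distrib, ← Finset.sum_add_distrib]
    exact Finset.sum_congr rfl fun i _ => by ring
  linarith

lemma integrable_Weps_rpow_mul_energy {N : ℕ} {α p ε : ℝ} (hα2 : α < 2) (hp : 1 < p) (hε : 0 < ε)
    {u : EuclideanSpace ℝ (Fin N) → ℝ} (hu : ContDiff ℝ 2 u) (hus : HasCompactSupport u)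
    (hupos : ∀ x, 0 ≤ u x) :
    Integrable (fun x => if u x = 0 then 0 else
      Weps α ε x ^ (p - 1) * u x ^ (p - 2) * ∑ i, pdR i u x ^ 2) := by
  obtain ⟨L, hL0, hL⟩ := exists_sq_fderiv_le hu hus hupos
  have hWc := continuous_Weps (N := N) hα2 hε
  have hfc : Continuous fun x => Weps α ε x ^ (p - 1) * u x ^ (p - 1) * (N * L) :=
    ((hWc.rpow_const fun _ => Or.inr (by linarith)).mul
      (hu.continuous.rpow_const fun _ => Or.inr (by linarith))).mul continuous_const
  have hfs : HasCompactSupport fun x => Weps α ε x ^ (p - 1) * u x ^ (p - 1) * (N * L) := by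
    refine hus.mono fun x hx hux => hx ?_
    simp [hux, Real.zero_rpow (sub_pos.2 hp).ne']
  refine (hfc.integrable_of_hasCompactSupport hfs).mono' ?_
    (Filter.Eventually.of_forall fun x => ?_)
  · refine Measurable.aestronglyMeasurable (Measurable.ite
      (hu.continuous.measurable (measurableSet_singleton 0)) measurable_const ?_)
    refine ((hWc.measurable.pow_const _).mul (hu.continuous.measurable.pow_const _)).mul
      (Finset.measurable_sum _ fun i _ => ?_)
    exact (((hu.continuous_fderiv (by norm_num)).clm_apply
      continuous_const).measurable).pow_const 2
  · have hW := (Weps_pos (α := α) hε x).le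
    have hux := hupos x
    split_ifs with h
    · rw [norm_zero]
      positivity
    · rw [Real.norm_of_nonneg (by positivity)]
      have hsum : ∑ i, pdR i u x ^ 2 ≤ N * L * u x := by
        calc ∑ i, pdR i u x ^ 2 ≤ ∑ _i : Fin N, L * u x :=
              Finset.sum_le_sum fun i _ => by simpa [pdR] using hL x (EuclideanSpace.single i 1)
          _ = N * L * u x := by simp [mul_assoc]
      have e : u x ^ (p - 1) = u x ^ (p - 2) * u x := by
        rw [← Real.rpow_add_one h]
        ring_nf
      calc _ ≤ Weps α ε x ^ (p - 1) * u x ^ (p - 2) * (N * L * u x) := by gcongr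
        _ = _ := by rw [e]; ring

theorem stmt11 (N : ℕ) (hN : 3 ≤ N) (α : ℝ) (hα0 : 0 ≤ α) (hα2 : α < 2)
    (p : ℝ) (hp : 1 < p) (ε : ℝ) (hε : 0 < ε) (γ : ℝ) (hγ : γ = (α - 2) * (p - 1))
    (u : EuclideanSpace ℝ (Fin N) → ℝ) (hu : ContDiff ℝ (⊤ : ℕ∞) u) (hus : HasCompactSupport u)
    (hupos : ∀ x, 0 ≤ u x) :
    (∫ x, if u x = 0 then 0 else
        Weps α ε x ^ (p - 1) * u x ^ (p - 2) * ∑ i, pdR i u x ^ 2) ≥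
      ∫ x, ‖x‖ ^ (-α) * Weps α ε x ^ p * u x ^ p *
        ((((N : ℝ) - 2) / p) ^ 2 * ‖x‖ ^ (α - 2) * (Weps α ε x)⁻¹
        - γ ^ 2 / p ^ 2 * ‖x‖ ^ (2 - α) * Weps α ε x
        + 2 * γ / p ^ 2 * ((N : ℝ) - α + p * (α - 2) * ‖x‖ ^ (2 - α) * Weps α ε x)) := by
  have hp0 : 0 < p := by linarith
  have hp1 : 0 < p - 1 := by linarith
  have hu2 : ContDiff ℝ 2 u := contDiff_infty.1 hu 2
  have huc := hu.continuous
  have hWc := continuous_Weps (N := N) hα2 hε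
  have hfin : Module.finrank ℝ (EuclideanSpace ℝ (Fin N)) = N := by simp
  have hfin3 : 3 ≤ Module.finrank ℝ (EuclideanSpace ℝ (Fin N)) := by rwa [hfin]
  have hXc : Continuous fun x => fderiv ℝ u x x :=
    (hu2.continuous_fderiv (by norm_num)).clm_apply continuous_id
  have hW1 : Continuous fun x : EuclideanSpace ℝ (Fin N) => Weps α ε x ^ (p - 1) :=
    hWc.rpow_const fun _ => Or.inr hp1.le
  have hup : Continuous fun x => u x ^ p := huc.rpow_const fun _ => Or.inr hp0.le
  have hup1 : Continuous fun x => u x ^ (p - 1) := huc.rpow_const fun _ => Or.inr hp1.le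
  set c : ℝ := ((N : ℝ) - 2) / p with hc
  set s : EuclideanSpace ℝ (Fin N) → ℝ := fun x => 1 - ε * Weps α ε x with hs
  have hsc : Continuous s := by fun_prop
  set ψ : EuclideanSpace ℝ (Fin N) → ℝ := fun x =>
    Weps α ε x ^ (p - 1) * (γ / p * s x + c) * u x ^ p with hψ
  set ψ' : EuclideanSpace ℝ (Fin N) → ℝ := fun x =>
    Weps α ε x ^ (p - 1) * (((α - 2) * (p - 1) * s x) * (γ / p * s x + c) -
      γ / p * (α - 2) * s x * (ε * Weps α ε x)) * u x ^ p +
      Weps α ε x ^ (p - 1) * (γ / p * s x + c) * (p * u x ^ (p - 1) * fderiv ℝ u x x) with hψ'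
  have hψc : Continuous ψ := by fun_prop
  have hdψ_cont : Continuous ψ' := by fun_prop
  have hψs : HasCompactSupport ψ := hus.mono fun x hx hux => hx <| by
    simp [hψ, hux, Real.zero_rpow hp0.ne']
  have hdψ_supp : HasCompactSupport ψ' := hus.mono fun x hx hux => hx <| by
    simp [hψ', hux, Real.zero_rpow hp0.ne', Real.zero_rpow hp1.ne']
  obtain ⟨C, hC⟩ := hψs.exists_bound_of_continuous hψc
  obtain ⟨R, hR⟩ := hψs.isCompact.isBounded.subset_ball 0
  have hDint := integrable_inv_sq_mul volume hfin3
    (f := fun x => ((N : ℝ) - 2) * ψ x + ψ' x) (by fun_prop) (hψs.mul_left.add hdψ_supp)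
  have hD := integral_inv_sq_divergence_eq_zero volume hfin3 (ψ := ψ) (ψ' := ψ') (R := R)
    (fun x _ => hasDerivAt_Weps_rpow_mul_ray hp hε _ _ (hu2.differentiable (by norm_num)) x)
    hC (fun x hx => image_eq_zero_of_notMem_tsupport fun h => by
      have := hR h
      rw [mem_ball_zero_iff] at this
      linarith) (by rwa [hfin])
  rw [hfin] at hD
  set b : EuclideanSpace ℝ (Fin N) → ℝ := fun x => Weps α ε x ^ (p - 1) * u x ^ p *
    (c ^ 2 + s x * (-(γ ^ 2 / p ^ 2) * s x +
      2 * γ / p ^ 2 * ((N : ℝ) - α + p * (α - 2) * s x))) with hb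
  have hbc : Continuous b := by fun_prop
  have hbs : HasCompactSupport b := hus.mono fun x hx hux => hx <| by
    simp [hb, hux, Real.zero_rpow hp0.ne']
  have hBint := integrable_inv_sq_mul volume hfin3 hbc hbs
  have hne : ∀ᵐ x : EuclideanSpace ℝ (Fin N), x ≠ 0 := by
    have : Nontrivial (EuclideanSpace ℝ (Fin N)) :=
      Module.nontrivial_of_finrank_pos (R := ℝ) (by omega)
    exact Measure.ae_ne volume 0
  have hBeq : (∫ x, ‖x‖ ^ (-α) * Weps α ε x ^ p * u x ^ p *
        (c ^ 2 * ‖x‖ ^ (α - 2) * (Weps α ε x)⁻¹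
        - γ ^ 2 / p ^ 2 * ‖x‖ ^ (2 - α) * Weps α ε x
        + 2 * γ / p ^ 2 * ((N : ℝ) - α + p * (α - 2) * ‖x‖ ^ (2 - α) * Weps α ε x))) =
      ∫ x, (‖x‖ ^ 2)⁻¹ * b x := by
    refine integral_congr_ae ?_
    filter_upwards [hne] with x hx
    have hn0 : 0 < ‖x‖ := norm_pos_iff.2 hx
    have hW := Weps_pos (α := α) hε x
    have hP := Real.rpow_pos_of_pos hn0 (2 - α)
    have e1 : ‖x‖ ^ (-α) = (‖x‖ ^ 2)⁻¹ * ‖x‖ ^ (2 - α) := by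
      rw [← Real.rpow_natCast, ← Real.rpow_neg hn0.le, ← Real.rpow_add hn0]
      norm_num
      ring_nf
    have e2 : ‖x‖ ^ (α - 2) = (‖x‖ ^ (2 - α))⁻¹ := by
      rw [← Real.rpow_neg hn0.le, neg_sub]
    have e3 : Weps α ε x ^ p = Weps α ε x ^ (p - 1) * Weps α ε x := by
      rw [← Real.rpow_add_one hW.ne', sub_add_cancel]
    have e4 : s x = ‖x‖ ^ (2 - α) * Weps α ε x := (norm_rpow_mul_Weps hε x).symm
    simp only [hb]
    rw [e1, e2, e3, e4]
    generalize ‖x‖ ^ (2 - α) = P at *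
    generalize Weps α ε x ^ (p - 1) = V at *
    generalize Weps α ε x = W at *
    field_simp
    ring
  rw [hBeq, ge_iff_le]
  have hsub : ∫ x, (‖x‖ ^ 2)⁻¹ * b x = ∫ x, ((‖x‖ ^ 2)⁻¹ * b x -
      2 / p * ((‖x‖ ^ 2)⁻¹ * (((N : ℝ) - 2) * ψ x + ψ' x))) := by
    rw [integral_sub hBint (hDint.const_mul _), integral_const_mul, hD]
    simp
  rw [hsub]
  refine integral_mono_ae (hBint.sub (hDint.const_mul _))
    (integrable_Weps_rpow_mul_energy hα2 hp hε hu2 hus hupos) ?_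
  filter_upwards [hne] with x hx
  by_cases h : u x = 0
  · simp [hb, hψ, hψ', h, Real.zero_rpow hp0.ne', Real.zero_rpow hp1.ne']
  rw [if_neg h]
  have hn0 : 0 < ‖x‖ := norm_pos_iff.2 hx
  have hW := Weps_pos (α := α) hε x
  have hux : 0 < u x := lt_of_le_of_ne (hupos x) (Ne.symm h)
  have hV := Real.rpow_pos_of_pos hW (p - 1)
  have hU := Real.rpow_pos_of_pos hux (p - 2)
  have e1 : u x ^ (p - 1) = u x ^ (p - 2) * u x := by
    rw [← Real.rpow_add_one h]
    ring_nf
  have e2 : u x ^ p = u x ^ (p - 2) * u x ^ 2 := by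
    rw [← Real.rpow_natCast (u x) 2, ← Real.rpow_add hux]
    norm_num
  have e3 : ε * Weps α ε x = 1 - s x := by simp [hs]
  have key := mul_le_mul_of_nonneg_left
    (sum_pdR_sq_ge u x (u x * (γ / p * s x + c) * (‖x‖ ^ 2)⁻¹)) (mul_pos hV hU).le
  refine le_trans (le_of_eq ?_) key
  simp only [hb, hψ, hψ']
  rw [e1, e2, e3]
  have hNc : (N : ℝ) = c * p + 2 := by
    rw [hc]
    field_simp
    ring
  rw [hNc, hγ]
  generalize s x = S
  generalize fderiv ℝ u x x = X
  generalize Weps α ε x ^ (p - 1) = V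
  generalize u x ^ (p - 2) = U
  clear_value c
  field_simp
  ring
end
end

section
/- Let N ≥ 3, α ∈ (0,2), β > 0 and b, c ∈ ℝ. Define φ(x) = (1+|x|^α)^{b/α}, c̃ = b(α+N−2)/2 + c and U(x) = c̃ |x|^{α−2} − (|x|^{2α−2}/(1+|x|^α)) ( −b²/4 + bα/2 ) + |x|^β. Then for every v ∈ C_c^∞(ℝ^N; ℂ) and every x ∈ ℝ^N \ {0}, setting ψ = v/√φ (a smooth function on ℝ^N \ {0}), one has the pointwise identity (−A_{b,c}ψ)(x) = φ(x)^{−1/2} [ −(1+|x|^α)Δv(x) + U(x) v(x) ]. -/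
open MeasureTheory Real

noncomputable section

/-- The `i`-th partial derivative of a complex-valued function on `ℝ^N`. -/
def pdC {N : ℕ} (i : Fin N) (f : EuclideanSpace ℝ (Fin N) → ℂ)
    (x : EuclideanSpace ℝ (Fin N)) : ℂ :=
  fderiv ℝ f x (EuclideanSpace.single i 1)

/-- The Laplacian of a complex-valued function on `ℝ^N`. -/
def lapC {N : ℕ} (f : EuclideanSpace ℝ (Fin N) → ℂ)
    (x : EuclideanSpace ℝ (Fin N)) : ℂ :=
  ∑ i, pdC i (pdC i f) x

/-- The elliptic operator `A_{b,c} = (1+|x|^α)Δ + b|x|^{α-2} x·∇ - c|x|^{α-2} - |x|^β`. -/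
def Abc {N : ℕ} (α β b c : ℝ) (f : EuclideanSpace ℝ (Fin N) → ℂ)
    (x : EuclideanSpace ℝ (Fin N)) : ℂ :=
  ((1 + ‖x‖ ^ α : ℝ) : ℂ) * lapC f x
    + ((b * ‖x‖ ^ (α - 2) : ℝ) : ℂ) * ∑ i, (x i : ℂ) * pdC i f x
    - ((c * ‖x‖ ^ (α - 2) : ℝ) : ℂ) * f x
    - ((‖x‖ ^ β : ℝ) : ℂ) * f x

/-- The gradient of `‖y‖ ^ s` away from the origin is `s * ‖y‖ ^ (s - 2) • y`. -/
theorem hasFDerivAt_norm_rpow_of_ne_zero {E : Type*} [NormedAddCommGroup E]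
    [InnerProductSpace ℝ E] (s : ℝ) {y : E} (hy : y ≠ 0) :
    HasFDerivAt (fun z : E => ‖z‖ ^ s) ((s * ‖y‖ ^ (s - 2)) • innerSL ℝ y) y := by
  have hpos : 0 < ‖y‖ := norm_pos_iff.mpr hy
  have h := ((hasStrictFDerivAt_norm_sq y).hasFDerivAt).rpow_const (p := s / 2)
    (Or.inl (by positivity))
  have hfun : (fun z : E => ‖z‖ ^ s) = fun z => (‖z‖ ^ 2) ^ (s / 2) := by
    funext z
    rw [← rpow_natCast, ← rpow_mul (norm_nonneg z)]
    congr 1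
    push_cast
    ring
  rw [hfun]
  convert h using 1
  have hexp : (‖y‖ ^ 2) ^ (s / 2 - 1) = ‖y‖ ^ (s - 2) := by
    rw [← rpow_natCast, ← rpow_mul (norm_nonneg y)]
    congr 1
    push_cast
    ring
  ext z
  simp [hexp]
  ring

/-- The gradient of `(1 + ‖y‖ ^ s) ^ q` away from the origin. -/
theorem hasFDerivAt_one_add_norm_rpow_rpow {E : Type*} [NormedAddCommGroup E]
    [InnerProductSpace ℝ E] (s q : ℝ) {y : E} (hy : y ≠ 0) :
    HasFDerivAt (fun z : E => (1 + ‖z‖ ^ s) ^ q)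
      ((q * s * ‖y‖ ^ (s - 2) * (1 + ‖y‖ ^ s) ^ (q - 1)) • innerSL ℝ y) y := by
  have h := ((hasFDerivAt_norm_rpow_of_ne_zero s hy).const_add 1).rpow_const (p := q)
    (Or.inl (by positivity))
  convert h using 1
  ext z
  simp
  ring

/-- Product rule for a real factor with radial gradient `k • y`. -/
theorem pdC_ofReal_mul {N : ℕ} (i : Fin N) {f : EuclideanSpace ℝ (Fin N) → ℂ}
    {w : EuclideanSpace ℝ (Fin N) → ℝ} {k : ℝ} {y : EuclideanSpace ℝ (Fin N)}
    (hf : DifferentiableAt ℝ f y) (hw : HasFDerivAt w (k • innerSL ℝ y) y) :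
    pdC i (fun z => (w z : ℂ) * f z) y = w y * pdC i f y + k * y i * f y := by
  have hw' : HasFDerivAt (fun z => (w z : ℂ)) (Complex.ofRealCLM.comp (k • innerSL ℝ y)) y :=
    Complex.ofRealCLM.hasFDerivAt.comp y hw
  rw [pdC, (hw'.fun_mul hf.hasFDerivAt).fderiv]
  simp [pdC, EuclideanSpace.inner_single_right]
  ring

theorem pdC_add {N : ℕ} (i : Fin N) {f g : EuclideanSpace ℝ (Fin N) → ℂ}
    {y : EuclideanSpace ℝ (Fin N)} (hf : DifferentiableAt ℝ f y) (hg : DifferentiableAt ℝ g y) :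
    pdC i (fun z => f z + g z) y = pdC i f y + pdC i g y := by
  simp [pdC, fderiv_fun_add hf hg]

theorem pdC_coord_mul {N : ℕ} (i : Fin N) {f : EuclideanSpace ℝ (Fin N) → ℂ}
    {y : EuclideanSpace ℝ (Fin N)} (hf : DifferentiableAt ℝ f y) :
    pdC i (fun z => (z i : ℂ) * f z) y = f y + y i * pdC i f y := by
  have hc : HasFDerivAt (fun z : EuclideanSpace ℝ (Fin N) => (z i : ℂ))
      (Complex.ofRealCLM.comp (EuclideanSpace.proj i)) y :=
    (Complex.ofRealCLM.comp (EuclideanSpace.proj (𝕜 := ℝ) i)).hasFDerivAt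
  rw [pdC, (hc.fun_mul hf.hasFDerivAt).fderiv]
  simp [pdC]
  ring

/-- The Laplacian of a product with a radial factor `w`, where `∇w = k • y` near `x` and
`∇k = m • x` at `x`. -/
theorem lapC_ofReal_mul {N : ℕ} {v : EuclideanSpace ℝ (Fin N) → ℂ} (hv : ContDiff ℝ 2 v)
    {w k : EuclideanSpace ℝ (Fin N) → ℝ} {m : ℝ} {x : EuclideanSpace ℝ (Fin N)}
    (hw : ∀ᶠ y in nhds x, HasFDerivAt w (k y • innerSL ℝ y) y)
    (hk : HasFDerivAt k (m • innerSL ℝ x) x) :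
    lapC (fun z => (w z : ℂ) * v z) x = w x * lapC v x
      + 2 * k x * ∑ i, (x i : ℂ) * pdC i v x + (N * k x + ‖x‖ ^ 2 * m) * v x := by
  have hdv : Differentiable ℝ v := hv.differentiable (by norm_num)
  have hpd : ∀ i, Differentiable ℝ (pdC i v) := fun i =>
    ((hv.fderiv_right (m := 1) (by norm_num)).differentiable (by norm_num)).clm_apply
      (differentiable_const _)
  have hcoord : ∀ i, DifferentiableAt ℝ (fun z : EuclideanSpace ℝ (Fin N) => (z i : ℂ)) x :=
    fun i => (Complex.ofRealCLM.comp (EuclideanSpace.proj (𝕜 := ℝ) i)).differentiableAt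
  have hwx := hw.self_of_nhds
  have hofReal : ∀ {g : EuclideanSpace ℝ (Fin N) → ℝ}, DifferentiableAt ℝ g x →
      DifferentiableAt ℝ (fun z => (g z : ℂ)) x := fun hg =>
    Complex.ofRealCLM.differentiableAt.comp x hg
  have hterm : ∀ i, pdC i (pdC i fun z => (w z : ℂ) * v z) x = w x * pdC i (pdC i v) x
      + 2 * k x * (x i * pdC i v x) + k x * v x + ((x i ^ 2 : ℝ) : ℂ) * (m * v x) := by
    intro i
    have heq : (pdC i fun z => (w z : ℂ) * v z) =ᶠ[nhds x]
        fun z => w z * pdC i v z + k z * (z i * v z) := by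
      filter_upwards [hw] with y hy
      rw [pdC_ofReal_mul i (hdv y) hy]
      ring
    have hxv := (hcoord i).fun_mul (hdv x)
    rw [pdC, heq.fderiv_eq]
    change pdC i (fun z => w z * pdC i v z + k z * (z i * v z)) x = _
    rw [pdC_add i ((hofReal hwx.differentiableAt).fun_mul (hpd i x))
        ((hofReal hk.differentiableAt).fun_mul hxv),
      pdC_ofReal_mul i (hpd i x) hwx, pdC_ofReal_mul i hxv hk, pdC_coord_mul i (hdv x)]
    push_cast
    ring
  have hnorm : ∑ i, ((x i ^ 2 : ℝ) : ℂ) = (‖x‖ : ℂ) ^ 2 := by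
    rw [← Complex.ofReal_sum, ← EuclideanSpace.real_norm_sq_eq]
    push_cast
    rfl
  simp only [lapC, hterm, Finset.sum_add_distrib, ← Finset.mul_sum, ← Finset.sum_mul, hnorm,
    Finset.sum_const, Finset.card_univ, Fintype.card_fin, nsmul_eq_mul]
  ring

theorem stmt14 (N : ℕ) (hN : 3 ≤ N) (α β b c : ℝ) (hα0 : 0 < α) (hα2 : α < 2) (hβ : 0 < β)
    (v : EuclideanSpace ℝ (Fin N) → ℂ) (hv : ContDiff ℝ (⊤ : ℕ∞) v) (hvs : HasCompactSupport v)
    (φ : EuclideanSpace ℝ (Fin N) → ℝ) (hφ : φ = fun x => (1 + ‖x‖ ^ α) ^ (b / α))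
    (c' : ℝ) (hc' : c' = b * (α + (N : ℝ) - 2) / 2 + c)
    (U : EuclideanSpace ℝ (Fin N) → ℝ)
    (hU : U = fun x => c' * ‖x‖ ^ (α - 2)
      - ‖x‖ ^ (2 * α - 2) / (1 + ‖x‖ ^ α) * (-(b ^ 2) / 4 + b * α / 2) + ‖x‖ ^ β)
    (x : EuclideanSpace ℝ (Fin N)) (hx : x ≠ 0) :
    -Abc α β b c (fun y => v y / (Real.sqrt (φ y) : ℂ)) x =
      ((1 / Real.sqrt (φ x) : ℝ) : ℂ) *
        (-(((1 + ‖x‖ ^ α : ℝ) : ℂ) * lapC v x) + ((U x : ℝ) : ℂ) * v x) := by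
  have hr : 0 < ‖x‖ := norm_pos_iff.mpr hx
  have hv2 : ContDiff ℝ 2 v := contDiff_infty.mp hv 2
  set p : ℝ := -(b / (2 * α)) with hp
  have hpα : p * α = -(b / 2) := by
    rw [hp]
    field_simp
  have hbase : ∀ y : EuclideanSpace ℝ (Fin N), 0 < 1 + ‖y‖ ^ α := fun y => by positivity
  have hsqrt : ∀ y, (√(φ y))⁻¹ = (1 + ‖y‖ ^ α) ^ p := by
    intro y
    rw [hφ, sqrt_eq_rpow, ← rpow_mul (hbase y).le, ← rpow_neg (hbase y).le, hp]
    congr 1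
    field_simp
  have hψ : (fun y => v y / (√(φ y) : ℂ))
      = fun y => (((1 + ‖y‖ ^ α) ^ p : ℝ) : ℂ) * v y := by
    funext y
    rw [← hsqrt y]
    push_cast
    ring
  have hw : ∀ y : EuclideanSpace ℝ (Fin N), y ≠ 0 → HasFDerivAt
      (fun z : EuclideanSpace ℝ (Fin N) => (1 + ‖z‖ ^ α) ^ p)
      ((p * α * ‖y‖ ^ (α - 2) * (1 + ‖y‖ ^ α) ^ (p - 1)) • innerSL ℝ y) y :=
    fun y hy => hasFDerivAt_one_add_norm_rpow_rpow α p hy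
  have hk : HasFDerivAt
      (fun z : EuclideanSpace ℝ (Fin N) => p * α * ‖z‖ ^ (α - 2) * (1 + ‖z‖ ^ α) ^ (p - 1))
      ((p * α * ((α - 2) * ‖x‖ ^ (α - 2 - 2) * (1 + ‖x‖ ^ α) ^ (p - 1)
        + ‖x‖ ^ (α - 2) * ((p - 1) * α * ‖x‖ ^ (α - 2) * (1 + ‖x‖ ^ α) ^ (p - 1 - 1))))
        • innerSL ℝ x) x := by
    have h := ((hasFDerivAt_norm_rpow_of_ne_zero (α - 2) hx).const_mul (p * α)).fun_mul
      (hasFDerivAt_one_add_norm_rpow_rpow α (p - 1) hx)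
    refine h.congr_fderiv ?_
    ext z
    simp
    ring
  have hlap := lapC_ofReal_mul hv2
    ((isOpen_ne.eventually_mem hx).mono hw) hk
  have hgrad : ∑ i, (x i : ℂ) * pdC i (fun y => (((1 + ‖y‖ ^ α) ^ p : ℝ) : ℂ) * v y) x
      = (((1 + ‖x‖ ^ α) ^ p : ℝ) : ℂ) * ∑ i, (x i : ℂ) * pdC i v x
        + ((p * α * ‖x‖ ^ (α - 2) * (1 + ‖x‖ ^ α) ^ (p - 1) : ℝ) : ℂ) * ‖x‖ ^ 2 * v x := by
    have hnorm : (‖x‖ : ℂ) ^ 2 = ∑ i, (x i : ℂ) ^ 2 := by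
      exact_mod_cast congrArg Complex.ofReal (EuclideanSpace.real_norm_sq_eq x)
    rw [hnorm, Finset.mul_sum, Finset.mul_sum, Finset.sum_mul, ← Finset.sum_add_distrib]
    refine Finset.sum_congr rfl fun i _ => ?_
    rw [pdC_ofReal_mul i (hv.differentiable (by simp) x) (hw x hx)]
    ring
  have hR4 : ‖x‖ ^ (α - 2 - 2) = ‖x‖ ^ (α - 2) / ‖x‖ ^ 2 := by
    rw [rpow_sub hr (α - 2) 2, rpow_two]
  have hRα : ‖x‖ ^ α = ‖x‖ ^ (α - 2) * ‖x‖ ^ 2 := by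
    rw [← rpow_two, ← rpow_add hr, sub_add_cancel]
  have hR2α : ‖x‖ ^ (2 * α - 2) = ‖x‖ ^ (α - 2) * (‖x‖ ^ (α - 2) * ‖x‖ ^ 2) := by
    rw [← hRα, ← rpow_add hr]
    congr 1
    ring
  have hp1 : (1 + ‖x‖ ^ α) ^ (p - 1) = (1 + ‖x‖ ^ α) ^ p / (1 + ‖x‖ ^ α) :=
    rpow_sub_one (hbase x).ne' p
  have hp2 : (1 + ‖x‖ ^ α) ^ (p - 1 - 1)
      = (1 + ‖x‖ ^ α) ^ p / (1 + ‖x‖ ^ α) / (1 + ‖x‖ ^ α) := by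
    rw [rpow_sub_one (hbase x).ne', hp1]
  have hinv : (1 / √(φ x) : ℝ) = (1 + ‖x‖ ^ α) ^ p := by rw [one_div, hsqrt]
  have hpα1 : (p - 1) * α = -(b / 2) - α := by linear_combination hpα
  rw [hψ, Abc, hlap, hgrad, hinv, hU, hc']
  simp only [hpα, hpα1, hp1, hp2, hR4, hR2α]
  have hA := hbase x
  generalize (1 + ‖x‖ ^ α) ^ p = W
  generalize 1 + ‖x‖ ^ α = A at hA
  generalize ‖x‖ ^ (α - 2) = R at *
  generalize ‖x‖ ^ β = B
  generalize ‖x‖ = r at *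
  have hAC : (A : ℂ) ≠ 0 := by exact_mod_cast hA.ne'
  have hrC : (r : ℂ) ≠ 0 := by exact_mod_cast hr.ne'
  push_cast
  field_simp
  ring
end
end
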